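/- Let γ : S^n → ℝ be positive and such that its positively 1-homogeneous extension γ̄ is twice continuously differentiable on ℝ^{n+1} \ {0}. Let W̃[γ] := ⋂_{ν ∈ S^n} {x ∈ ℝ^{n+1} : ⟨x, ν⟩ ≤ γ(ν)} with frontier W_γ, and let ξ_γ = ∇γ̄ be the Cahn-Hoffman map. Then γ̄ is a convex function on ℝ^{n+1} if and only if ξ_γ(S^n) = W_γ. (Paper's Theorem 4.5 (ii), equivalence of (a) and (b).) -/

import Mathlib

open scoped RealInnerProductSpace

/-- The Wulff body `W̃[γ] = ⋂_{‖ν‖=1} {x : ⟨x,ν⟩ ≤ γ(ν)}`, where `γ'` is the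
1-homogeneous extension of the integrand `γ` (so `γ' ν = γ ν` on the unit sphere). -/
def wulffBody (n : ℕ) (γ' : EuclideanSpace ℝ (Fin (n + 1)) → ℝ) :
    Set (EuclideanSpace ℝ (Fin (n + 1))) :=
  ⋂ ν ∈ Metric.sphere (0 : EuclideanSpace ℝ (Fin (n + 1))) 1, {x | ⟪x, ν⟫ ≤ γ' ν}

theorem mem_wulffBody {n : ℕ} {γ' : EuclideanSpace ℝ (Fin (n + 1)) → ℝ}
    {x : EuclideanSpace ℝ (Fin (n + 1))} :
    x ∈ wulffBody n γ' ↔ ∀ ν : EuclideanSpace ℝ (Fin (n + 1)), ‖ν‖ = 1 → ⟪x, ν⟫ ≤ γ' ν := by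
  simp [wulffBody]

theorem isClosed_wulffBody (n : ℕ) (γ' : EuclideanSpace ℝ (Fin (n + 1)) → ℝ) :
    IsClosed (wulffBody n γ') :=
  isClosed_biInter fun _ _ => isClosed_le (by fun_prop) continuous_const

/-- For a positively 1-homogeneous function, the inequalities defining the Wulff body extend
from the unit sphere to the whole space. -/
theorem inner_le_of_mem_wulffBody {n : ℕ} {γ' : EuclideanSpace ℝ (Fin (n + 1)) → ℝ}
    (hhom : ∀ r : ℝ, 0 ≤ r → ∀ x : EuclideanSpace ℝ (Fin (n + 1)), γ' (r • x) = r * γ' x)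
    {x : EuclideanSpace ℝ (Fin (n + 1))} (hx : x ∈ wulffBody n γ')
    (y : EuclideanSpace ℝ (Fin (n + 1))) : ⟪x, y⟫ ≤ γ' y := by
  rcases eq_or_ne y 0 with rfl | hy
  · have h0 := hhom 0 le_rfl 0
    simp only [zero_smul, zero_mul] at h0
    simp [h0]
  · have hy' : ‖y‖ ≠ 0 := norm_ne_zero_iff.mpr hy
    have h := mem_wulffBody.mp hx (‖y‖⁻¹ • y) (by simp [norm_smul, hy'])
    rw [hhom _ (by positivity), inner_smul_right] at h
    exact le_of_mul_le_mul_left h (by positivity)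

/-- A point of the Wulff body on one of its supporting hyperplanes lies on the frontier. -/
theorem mem_frontier_wulffBody_of_inner_eq {n : ℕ} {γ' : EuclideanSpace ℝ (Fin (n + 1)) → ℝ}
    {x ν : EuclideanSpace ℝ (Fin (n + 1))} (hx : x ∈ wulffBody n γ') (hν : ‖ν‖ = 1)
    (h : ⟪x, ν⟫ = γ' ν) : x ∈ frontier (wulffBody n γ') := by
  rw [(isClosed_wulffBody n γ').frontier_eq]
  refine ⟨hx, fun hint => ?_⟩
  obtain ⟨ε, hε, hball⟩ := Metric.mem_nhds_iff.mp (mem_interior_iff_mem_nhds.mp hint)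
  have hmem : x + (ε / 2) • ν ∈ wulffBody n γ' := hball (by
    rw [Metric.mem_ball, dist_self_add_left, norm_smul, hν, mul_one,
      Real.norm_of_nonneg (by positivity)]
    linarith)
  have := mem_wulffBody.mp hmem ν hν
  rw [inner_add_left, real_inner_smul_left, real_inner_self_eq_norm_sq, hν, h] at this
  linarith

/-- Every frontier point of the Wulff body lies on one of its supporting hyperplanes. -/
theorem exists_inner_eq_of_mem_frontier_wulffBody {n : ℕ}
    {γ' : EuclideanSpace ℝ (Fin (n + 1)) → ℝ}
    (hcont : ContinuousOn γ' (Metric.sphere (0 : EuclideanSpace ℝ (Fin (n + 1))) 1))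
    {x : EuclideanSpace ℝ (Fin (n + 1))} (hx : x ∈ frontier (wulffBody n γ')) :
    ∃ ν : EuclideanSpace ℝ (Fin (n + 1)), ‖ν‖ = 1 ∧ ⟪x, ν⟫ = γ' ν := by
  rw [(isClosed_wulffBody n γ').frontier_eq] at hx
  obtain ⟨hx, hint⟩ := hx
  by_contra! hne
  apply hint
  obtain ⟨ν, hν, hmin⟩ := (isCompact_sphere (0 : EuclideanSpace ℝ (Fin (n + 1))) 1).exists_isMinOn
    (NormedSpace.sphere_nonempty.mpr zero_le_one)
    (hcont.sub (f := γ') (g := fun ν => ⟪x, ν⟫) (by fun_prop))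
  rw [mem_sphere_zero_iff_norm] at hν
  have hm : 0 < γ' ν - ⟪x, ν⟫ :=
    sub_pos.mpr (lt_of_le_of_ne (mem_wulffBody.mp hx ν hν) (hne ν hν))
  rw [mem_interior_iff_mem_nhds, Metric.mem_nhds_iff]
  refine ⟨_, hm, fun y hy => mem_wulffBody.mpr fun μ hμ => ?_⟩
  have h1 : γ' ν - ⟪x, ν⟫ ≤ γ' μ - ⟪x, μ⟫ := hmin (mem_sphere_zero_iff_norm.mpr hμ)
  have h2 := real_inner_le_norm (y - x) μ
  rw [inner_sub_left, hμ, mul_one] at h2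
  rw [mem_ball_iff_norm] at hy
  linarith

section Gradient

variable {E : Type*} [NormedAddCommGroup E] [InnerProductSpace ℝ E] [CompleteSpace E]

theorem DifferentiableAt.hasDerivAt_comp_add_smul {f : E → ℝ} {x : E}
    (hf : DifferentiableAt ℝ f x) (v : E) :
    HasDerivAt (fun t : ℝ => f (x + t • v)) ⟪gradient f x, v⟫ 0 := by
  have h := hf.hasFDerivAt.hasLineDerivAt v
  rwa [HasLineDerivAt, ← InnerProductSpace.toDual_symm_apply] at h

/-- Euler's identity for functions that are homogeneous of degree one. -/
theorem inner_gradient_self_of_homogeneous {f : E → ℝ} {x : E} (hf : DifferentiableAt ℝ f x)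
    (hhom : ∀ r : ℝ, 0 ≤ r → ∀ x : E, f (r • x) = r * f x) : ⟪gradient f x, x⟫ = f x := by
  have h1 : HasDerivAt (fun t : ℝ => (1 + t) * f x) (f x) 0 := by
    simpa using ((hasDerivAt_id (0 : ℝ)).const_add 1).mul_const (f x)
  refine (hf.hasDerivAt_comp_add_smul x).unique (h1.congr_of_eventuallyEq ?_)
  filter_upwards [eventually_gt_nhds (show (-1 : ℝ) < 0 by norm_num)] with t ht
  rw [← hhom (1 + t) (by linarith), add_smul, one_smul]

/-- The gradient of a convex function that is homogeneous of degree one is dominated by it. -/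
theorem ConvexOn.inner_gradient_le_of_homogeneous {f : E → ℝ} {x : E}
    (hconv : ConvexOn ℝ Set.univ f) (hf : DifferentiableAt ℝ f x)
    (hhom : ∀ r : ℝ, 0 ≤ r → ∀ x : E, f (r • x) = r * f x) (y : E) :
    ⟪gradient f x, y⟫ ≤ f y := by
  have hline : ConvexOn ℝ Set.univ (fun t : ℝ => f (x + t • y)) := by
    simpa [Function.comp_def, AffineMap.lineMap_apply, add_comm] using
      hconv.comp_affineMap (AffineMap.lineMap x (x + y) : ℝ →ᵃ[ℝ] E)
  have h1 := hline.le_slope_of_hasDerivAt (Set.mem_univ 0) (Set.mem_univ 1) one_pos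
    (hf.hasDerivAt_comp_add_smul y)
  have h2 := hconv.2 (Set.mem_univ x) (Set.mem_univ y) (one_half_pos (α := ℝ)).le
    (one_half_pos (α := ℝ)).le (add_halves 1)
  rw [← smul_add, hhom _ (by norm_num)] at h2
  simp only [slope_def_field, one_smul, zero_smul, add_zero, sub_zero, div_one] at h1
  simp only [smul_eq_mul] at h2
  linarith

/-- A differentiable function touched from below by a linear functional has gradient representing
that functional at the point of contact. -/
theorem gradient_eq_of_inner_le {f : E → ℝ} {x v : E} (hf : DifferentiableAt ℝ f v)
    (hle : ∀ y, ⟪x, y⟫ ≤ f y) (heq : ⟪x, v⟫ = f v) : gradient f v = x := by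
  have hmin : IsLocalMin (fun y => f y - ⟪x, y⟫) v :=
    Filter.Eventually.of_forall fun y => by
      have := hle y
      simp only [heq]
      linarith
  have h0 := hmin.hasFDerivAt_eq_zero (hf.hasFDerivAt.sub (innerSL ℝ x).hasFDerivAt)
  refine ext_inner_right ℝ fun y => ?_
  have hy := DFunLike.congr_fun h0 y
  rw [gradient, InnerProductSpace.toDual_symm_apply]
  simpa [sub_eq_zero] using hy

end Gradient

/-- Let `γ : S^n → ℝ` be positive with 1-homogeneous extension `γ̄` of
class C² away from the origin. Then `γ̄` is convex if and only if the image of the unit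
sphere under the Cahn-Hoffman map `ξ_γ = ∇γ̄` equals the Wulff shape `W_γ` (the frontier
of the Wulff body). (Paper's Theorem 4.5 (ii), (a) ⇔ (b).) -/
theorem convex_iff_cahnHoffman_image_eq_wulffShape
    (n : ℕ) (γ' : EuclideanSpace ℝ (Fin (n + 1)) → ℝ)
    (hhom : ∀ r : ℝ, 0 ≤ r → ∀ x : EuclideanSpace ℝ (Fin (n + 1)), γ' (r • x) = r * γ' x)
    (hpos : ∀ ν : EuclideanSpace ℝ (Fin (n + 1)), ‖ν‖ = 1 → 0 < γ' ν)
    (hC2 : ContDiffOn ℝ 2 γ' {(0 : EuclideanSpace ℝ (Fin (n + 1)))}ᶜ) :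
    ConvexOn ℝ Set.univ γ' ↔
      gradient γ' '' Metric.sphere (0 : EuclideanSpace ℝ (Fin (n + 1))) 1 =
        frontier (wulffBody n γ') := by
  have hdiff : ∀ x : EuclideanSpace ℝ (Fin (n + 1)), x ≠ 0 → DifferentiableAt ℝ γ' x := fun x hx =>
    (hC2.contDiffAt (isOpen_compl_singleton.mem_nhds hx)).differentiableAt (by norm_num)
  have hne : ∀ ν : EuclideanSpace ℝ (Fin (n + 1)), ‖ν‖ = 1 → ν ≠ 0 := fun ν hν h => by
    simp [h] at hν
  constructor
  · intro hconv
    ext x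
    constructor
    · rintro ⟨ν, hν, rfl⟩
      rw [mem_sphere_zero_iff_norm] at hν
      have hd := hdiff ν (hne ν hν)
      exact mem_frontier_wulffBody_of_inner_eq
        (mem_wulffBody.mpr fun μ _ => hconv.inner_gradient_le_of_homogeneous hd hhom μ) hν
        (inner_gradient_self_of_homogeneous hd hhom)
    · intro hx
      obtain ⟨ν, hν, h⟩ := exists_inner_eq_of_mem_frontier_wulffBody (fun ν hν =>
        (hdiff ν (hne ν (mem_sphere_zero_iff_norm.mp hν))).continuousAt.continuousWithinAt) hx
      have hmem := (isClosed_wulffBody n γ').frontier_subset hx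
      exact ⟨ν, mem_sphere_zero_iff_norm.mpr hν,
        gradient_eq_of_inner_le (hdiff ν (hne ν hν)) (inner_le_of_mem_wulffBody hhom hmem) h⟩
  · intro himage
    have hsupp : ∀ z : EuclideanSpace ℝ (Fin (n + 1)), ∃ w, (∀ y, ⟪w, y⟫ ≤ γ' y) ∧
        ⟪w, z⟫ = γ' z := by
      have hunit : ∀ ν : EuclideanSpace ℝ (Fin (n + 1)), ‖ν‖ = 1 →
          ∀ y, ⟪gradient γ' ν, y⟫ ≤ γ' y := fun ν hν =>
        inner_le_of_mem_wulffBody hhom ((isClosed_wulffBody n γ').frontier_subset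
          (himage ▸ Set.mem_image_of_mem _ (mem_sphere_zero_iff_norm.mpr hν)))
      intro z
      obtain ⟨ν, hν, hz⟩ : ∃ ν : EuclideanSpace ℝ (Fin (n + 1)), ‖ν‖ = 1 ∧ z = ‖z‖ • ν := by
        rcases eq_or_ne z 0 with rfl | hz
        · obtain ⟨ν, hν⟩ := exists_norm_eq (EuclideanSpace ℝ (Fin (n + 1))) zero_le_one
          exact ⟨ν, hν, by simp⟩
        · have hz' : ‖z‖ ≠ 0 := norm_ne_zero_iff.mpr hz
          exact ⟨‖z‖⁻¹ • z, by simp [norm_smul, hz'], by simp [smul_smul, hz']⟩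
      refine ⟨gradient γ' ν, hunit ν hν, ?_⟩
      rw [hz, inner_smul_right, hhom _ (norm_nonneg z),
        inner_gradient_self_of_homogeneous (hdiff ν (hne ν hν)) hhom]
    refine ⟨convex_univ, fun x _ y _ a b ha hb _ => ?_⟩
    obtain ⟨w, hw, hz⟩ := hsupp (a • x + b • y)
    rw [← hz, inner_add_right, inner_smul_right, inner_smul_right]
    exact add_le_add (mul_le_mul_of_nonneg_left (hw x) ha) (mul_le_mul_of_nonneg_left (hw y) hb)
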